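/- Let S be the unit sphere in ℝ³ and E an ellipsoid contained in the closed unit ball. If S ∩ E contains three distinct points M, N, O, then S ∩ E contains the entire circle passing through M, N, O. -/

import Mathlib

open scoped RealInnerProductSpace

section

variable {V : Type*} [NormedAddCommGroup V] [InnerProductSpace ℝ V]

/-- The second intersection point of the unit sphere with the line through `m` directed by `v`. -/
lemma norm_second_inter_unit_sphere {m v : V} (hm : ‖m‖ = 1) (hv : v ≠ 0) :
    ‖m - (2 * ⟪m, v⟫ / ‖v‖ ^ 2) • v‖ = 1 := by
  have hv' : ‖v‖ ≠ 0 := norm_ne_zero_iff.mpr hv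
  rw [← sq_eq_sq₀ (norm_nonneg _) zero_le_one, norm_sub_sq_real, norm_smul, mul_pow,
    Real.norm_eq_abs, sq_abs, real_inner_smul_right, hm]
  field_simp
  ring

/-- Chords of the unit sphere through a contact point `m` are mapped into the unit ball. -/
lemma chord_inequality {f : V →ᵃ[ℝ] V} (hf : ∀ u : V, ‖u‖ = 1 → ‖f u‖ ≤ 1) {m : V}
    (hm : ‖m‖ = 1) (hfm : ‖f m‖ = 1) (v : V) :
    ⟪m, v⟫ * (⟪m, v⟫ * ‖f.linear v‖ ^ 2 - ‖v‖ ^ 2 * ⟪f m, f.linear v⟫) ≤ 0 := by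
  rcases eq_or_ne v 0 with rfl | hv
  · simp
  have hv' : 0 < ‖v‖ := norm_pos_iff.mpr hv
  set r := 2 * ⟪m, v⟫ / ‖v‖ ^ 2 with hr
  have h1 := hf _ (norm_second_inter_unit_sphere hm hv)
  have h2 : f (m - r • v) = f m - r • f.linear v := by
    have := f.map_vadd m (-(r • v))
    simp only [vadd_eq_add, map_neg, map_smul] at this
    rw [sub_eq_neg_add, this]
    abel
  rw [← hr, h2, ← sq_le_one_iff₀ (norm_nonneg _), norm_sub_sq_real, norm_smul, mul_pow,
    Real.norm_eq_abs, sq_abs, real_inner_smul_right, hfm] at h1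
  have h3 : ⟪m, v⟫ * (⟪m, v⟫ * ‖f.linear v‖ ^ 2 - ‖v‖ ^ 2 * ⟪f m, f.linear v⟫) =
      ‖v‖ ^ 4 / 4 * (r ^ 2 * ‖f.linear v‖ ^ 2 - 2 * (r * ⟪f m, f.linear v⟫)) := by
    rw [hr]
    field_simp
    ring
  rw [h3]
  exact mul_nonpos_of_nonneg_of_nonpos (by positivity) (by linarith)

lemma inner_linear_nonneg_of_inner_eq_zero {f : V →ᵃ[ℝ] V}
    (hf : ∀ u : V, ‖u‖ = 1 → ‖f u‖ ≤ 1) {m : V} (hm : ‖m‖ = 1) (hfm : ‖f m‖ = 1) {w : V}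
    (hw : ⟪m, w⟫ = 0) : 0 ≤ ⟪f m, f.linear w⟫ := by
  rcases eq_or_ne w 0 with rfl | hw0
  · simp
  let h : ℝ → ℝ := fun t ↦ ‖w + t • m‖ ^ 2 * ⟪f m, f.linear w + t • f.linear m⟫ -
    t * ‖f.linear w + t • f.linear m‖ ^ 2
  have hc : Continuous h := by fun_prop
  have hpos : ∀ t : ℝ, 0 < t → 0 ≤ h t := by
    intro t ht
    have h1 := chord_inequality hf hm hfm (w + t • m)
    have h2 : ⟪m, w + t • m⟫ = t := by
      rw [inner_add_right, hw, real_inner_smul_right, real_inner_self_eq_norm_sq, hm]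
      ring
    rw [h2, map_add, map_smul] at h1
    have h3 := nonpos_of_mul_nonpos_right h1 ht
    simp only [h]
    linarith
  have h0 : 0 ≤ h 0 :=
    ge_of_tendsto ((hc.tendsto 0).mono_left (nhdsWithin_le_nhds (s := Set.Ioi 0)))
      (eventually_mem_nhdsWithin.mono fun t ht ↦ hpos t ht)
  simp only [h, zero_smul, add_zero, zero_mul, sub_zero] at h0
  have : 0 < ‖w‖ ^ 2 := by have := norm_pos_iff.mpr hw0; positivity
  exact nonneg_of_mul_nonneg_right h0 this

/-- First-order condition at a contact point of the ellipsoid with the unit sphere. -/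
lemma inner_linear_eq_mul_inner {f : V →ᵃ[ℝ] V} (hf : ∀ u : V, ‖u‖ = 1 → ‖f u‖ ≤ 1) {m : V}
    (hm : ‖m‖ = 1) (hfm : ‖f m‖ = 1) (v : V) :
    ⟪f m, f.linear v⟫ = ⟪f m, f.linear m⟫ * ⟪m, v⟫ := by
  have hw : ⟪m, v - ⟪m, v⟫ • m⟫ = 0 := by
    rw [inner_sub_right, real_inner_smul_right, real_inner_self_eq_norm_sq, hm]
    ring
  have h1 := inner_linear_nonneg_of_inner_eq_zero hf hm hfm hw
  have h2 := inner_linear_nonneg_of_inner_eq_zero hf hm hfm (w := -(v - ⟪m, v⟫ • m))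
    (by rw [inner_neg_right, hw, neg_zero])
  rw [map_neg, inner_neg_right] at h2
  have h3 := le_antisymm (neg_nonneg.mp h2) h1
  rw [map_sub, map_smul, inner_sub_right, real_inner_smul_right] at h3
  linarith

lemma one_sub_inner_eq_mul {f : V →ᵃ[ℝ] V} (hf : ∀ u : V, ‖u‖ = 1 → ‖f u‖ ≤ 1) {m n : V}
    (hm : ‖m‖ = 1) (hfm : ‖f m‖ = 1) :
    1 - ⟪f m, f n⟫ = ⟪f m, f.linear m⟫ * (1 - ⟪m, n⟫) := by
  have h := inner_linear_eq_mul_inner hf hm hfm (n - m)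
  have h1 : f.linear (n - m) = f n - f m := f.linearMap_vsub n m
  rw [h1, inner_sub_right, inner_sub_right, real_inner_self_eq_norm_sq,
    real_inner_self_eq_norm_sq, hm, hfm] at h
  linarith

lemma multiplier_eq {f : V →ᵃ[ℝ] V} (hf : ∀ u : V, ‖u‖ = 1 → ‖f u‖ ≤ 1) {m n : V}
    (hm : ‖m‖ = 1) (hfm : ‖f m‖ = 1) (hn : ‖n‖ = 1) (hfn : ‖f n‖ = 1) (hmn : m ≠ n) :
    ⟪f m, f.linear m⟫ = ⟪f n, f.linear n⟫ := by
  have h1 := one_sub_inner_eq_mul hf (n := n) hm hfm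
  have h2 := one_sub_inner_eq_mul hf (n := m) hn hfn
  rw [real_inner_comm, real_inner_comm m n] at h2
  have h3 : 1 - ⟪m, n⟫ ≠ 0 := fun h ↦
    hmn ((inner_eq_one_iff_of_norm_eq_one (𝕜 := ℝ) hm hn).mp (by linarith))
  exact mul_right_cancel₀ h3 (h1.symm.trans h2)

lemma norm_sq_add_smul_add_smul {a b c : V} (ha : ‖a‖ = 1) (hb : ‖b‖ = 1) (hc : ‖c‖ = 1)
    (s t : ℝ) :
    ‖a + s • (b - a) + t • (c - a)‖ ^ 2 - 1 =
      -2 * ((1 - s - t) * s * (1 - ⟪a, b⟫) + (1 - s - t) * t * (1 - ⟪a, c⟫) +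
        s * t * (1 - ⟪b, c⟫)) := by
  have ha' : ⟪a, a⟫ = 1 := by rw [real_inner_self_eq_norm_sq, ha, one_pow]
  have hb' : ⟪b, b⟫ = 1 := by rw [real_inner_self_eq_norm_sq, hb, one_pow]
  have hc' : ⟪c, c⟫ = 1 := by rw [real_inner_self_eq_norm_sq, hc, one_pow]
  rw [← real_inner_self_eq_norm_sq]
  simp only [inner_add_left, inner_add_right, inner_sub_left, inner_sub_right,
    real_inner_smul_left, real_inner_smul_right, ha', hb', hc', real_inner_comm a b,
    real_inner_comm a c, real_inner_comm b c]
  ring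

lemma exists_eq_add_smul_add_smul_of_mem_affineSpan {a b c p : V}
    (hp : p ∈ affineSpan ℝ {a, b, c}) :
    ∃ s t : ℝ, p = a + s • (b - a) + t • (c - a) := by
  have h := AffineSubspace.vsub_mem_direction hp
    (mem_affineSpan ℝ (Set.mem_insert a {b, c}))
  rw [direction_affineSpan, vectorSpan_eq_span_vsub_set_right ℝ (Set.mem_insert a {b, c}),
    Set.image_insert_eq, Set.image_insert_eq, Set.image_singleton, vsub_self,
    Submodule.span_insert_zero, Submodule.mem_span_pair] at h
  obtain ⟨s, t, h⟩ := h
  refine ⟨s, t, ?_⟩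
  rw [add_assoc]
  simp only [vsub_eq_sub] at h
  rw [h]
  abel

end

/-- If an ellipsoid `E` (image of the unit sphere of `ℝ³` under an invertible affine map)
is contained in the closed unit ball and the intersection of `E` with the unit sphere `S`
contains three distinct points `M, N, O`, then it contains the whole circle through
`M, N, O` (the intersection of `S` with the plane spanned by `M, N, O`). -/
theorem sphere_inter_ellipsoid_circle
    (f : EuclideanSpace ℝ (Fin 3) →ᵃ[ℝ] EuclideanSpace ℝ (Fin 3))
    (hf : Function.Bijective f)
    (E : Set (EuclideanSpace ℝ (Fin 3))) (hE : E = f '' Metric.sphere 0 1)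
    (hEball : E ⊆ Metric.closedBall 0 1)
    (M N O : EuclideanSpace ℝ (Fin 3)) (hMN : M ≠ N) (hNO : N ≠ O) (hMO : M ≠ O)
    (hM : M ∈ Metric.sphere (0 : EuclideanSpace ℝ (Fin 3)) 1 ∩ E)
    (hN : N ∈ Metric.sphere (0 : EuclideanSpace ℝ (Fin 3)) 1 ∩ E)
    (hO : O ∈ Metric.sphere (0 : EuclideanSpace ℝ (Fin 3)) 1 ∩ E) :
    Metric.sphere (0 : EuclideanSpace ℝ (Fin 3)) 1 ∩
        (affineSpan ℝ {M, N, O} : Set (EuclideanSpace ℝ (Fin 3))) ⊆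
      Metric.sphere (0 : EuclideanSpace ℝ (Fin 3)) 1 ∩ E := by
  subst hE
  obtain ⟨hM1, m, hm, rfl⟩ := hM
  obtain ⟨hN1, n, hn, rfl⟩ := hN
  obtain ⟨hO1, o, ho, rfl⟩ := hO
  have hball : ∀ u, ‖u‖ = 1 → ‖f u‖ ≤ 1 := fun u hu ↦
    mem_closedBall_zero_iff.mp (hEball ⟨u, mem_sphere_zero_iff_norm.mpr hu, rfl⟩)
  rw [mem_sphere_zero_iff_norm] at hM1 hN1 hO1 hm hn ho
  rintro P ⟨hP, hPs⟩
  refine ⟨hP, ?_⟩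
  rw [mem_sphere_zero_iff_norm] at hP
  obtain ⟨s, t, rfl⟩ := exists_eq_add_smul_add_smul_of_mem_affineSpan hPs
  refine ⟨m + s • (n - m) + t • (o - m), ?_, ?_⟩
  · have hmn := one_sub_inner_eq_mul hball (n := n) hm hM1
    have hmo := one_sub_inner_eq_mul hball (n := o) hm hM1
    have hno := one_sub_inner_eq_mul hball (n := o) hn hN1
    rw [← multiplier_eq hball hm hM1 hn hN1 (ne_of_apply_ne f hMN)] at hno
    have h1 := norm_sq_add_smul_add_smul hm hn ho s t
    have h2 := norm_sq_add_smul_add_smul hM1 hN1 hO1 s t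
    rw [hP, hmn, hmo, hno] at h2
    have hk : ⟪f m, f.linear m⟫ ≠ 0 := fun hk ↦ by
      rw [hk, zero_mul] at hmn
      exact hMN ((inner_eq_one_iff_of_norm_eq_one (𝕜 := ℝ) hM1 hN1).mp (by linarith))
    have h3 : ⟪f m, f.linear m⟫ * (‖m + s • (n - m) + t • (o - m)‖ ^ 2 - 1) = 0 := by
      rw [h1]
      linarith
    have h4 := (mul_eq_zero.mp h3).resolve_left hk
    rw [mem_sphere_zero_iff_norm, ← sq_eq_sq₀ (norm_nonneg _) zero_le_one]
    linarith
  · have h1 : f.linear (n - m) = f n - f m := f.linearMap_vsub n m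
    have h2 : f.linear (o - m) = f o - f m := f.linearMap_vsub o m
    have h3 := f.map_vadd m (s • (n - m) + t • (o - m))
    simp only [vadd_eq_add, map_add, map_smul, h1, h2] at h3
    rw [add_assoc, add_comm, h3]
    abel
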